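/- Assume A is commutative and that G is κ-decaying with decay constant C for some κ : G → [1,∞). Let f ∈ C_c(Σ) take its values in the fixed-point algebra A^α = {a ∈ A : α_g(a) = a for all g ∈ G}. Then ‖Λ_Σ(f)‖ ≤ C ‖f‖_{α,κ}. -/

import Mathlib

open scoped ComplexOrder

noncomputable section

namespace BCFourier

/-- A twisted (unital, discrete) C*-dynamical system `Σ = (A, G, α, σ)`. -/
structure TwistedSystem (A : Type*) (G : Type*) [CStarAlgebra A] [Group G] where
  α : G → (A ≃⋆ₐ[ℂ] A)
  σ : G → G → A
  σ_unitary : ∀ g h, σ g h ∈ unitary A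
  alpha_mul : ∀ g h a, α g (α h a) = σ g h * α (g * h) a * star (σ g h)
  sigma_cocycle : ∀ g h k, σ g h * σ (g * h) k = α g (σ h k) * σ g (h * k)
  sigma_one_left : ∀ g, σ 1 g = 1
  sigma_one_right : ∀ g, σ g 1 = 1

variable {A G B : Type*} [CStarAlgebra A] [Group G] [CStarAlgebra B]

/-- Membership in the Hilbert `A`-module `A^Σ`:  unconditional norm convergence of
`∑_g α_g⁻¹(ξ(g)* ξ(g))`. -/
def MemAS (S : TwistedSystem A G) (ξ : G → A) : Prop :=
  Summable fun g => (S.α g).symm (star (ξ g) * ξ g)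

/-- The `A`-valued inner product `⟨ξ, η⟩_α = ∑_g α_g⁻¹(ξ(g)* η(g))` on `A^Σ`. -/
def innerAS (S : TwistedSystem A G) (ξ η : G → A) : A :=
  ∑' g, (S.α g).symm (star (ξ g) * η g)

/-- The norm `‖ξ‖_α = ‖⟨ξ,ξ⟩_α‖^{1/2}` on `A^Σ`. -/
def normAS (S : TwistedSystem A G) (ξ : G → A) : ℝ :=
  Real.sqrt ‖innerAS S ξ ξ‖

/-- Abstract characterization of the reduced twisted crossed product `C*_r(Σ)`:
a C*-algebra `B` together with a copy `ι` of `A`, unitaries `u g` implementing the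
twisted action, and the canonical faithful conditional expectation `E`, such that
the Fourier coefficients `x̂(g) = E(x u_g*)` lie in `A^Σ`, `E(x* x) = ⟨x̂, x̂⟩_α`,
and `B` is topologically generated by the elements `ι(a) u g`. -/
structure CrossedProduct {A G : Type*} [CStarAlgebra A] [Group G]
    (S : TwistedSystem A G) (B : Type*) [CStarAlgebra B] where
  ι : A →⋆ₐ[ℂ] B
  ι_isometric : ∀ a, ‖ι a‖ = ‖a‖
  u : G → B
  u_unitary : ∀ g, u g ∈ unitary B
  u_one : u 1 = 1
  covariance : ∀ g a, u g * ι a = ι (S.α g a) * u g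
  u_mul : ∀ g h, u g * u h = ι (S.σ g h) * u (g * h)
  E : B →L[ℂ] A
  E_iota : ∀ a, E (ι a) = a
  E_perp : ∀ a g, g ≠ 1 → E (ι a * u g) = 0
  E_contractive : ∀ x, ‖E x‖ ≤ ‖x‖
  E_faithful : ∀ x, E (star x * x) = 0 → x = 0
  hat_mem : ∀ x : B, MemAS S fun g => E (x * star (u g))
  E_inner : ∀ x : B,
    E (star x * x) = innerAS S (fun g => E (x * star (u g))) fun g => E (x * star (u g))
  generated : Dense (↑(Submodule.span ℂ {b : B | ∃ a g, b = ι a * u g}) : Set B)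

variable {S : TwistedSystem A G}

/-- The Fourier transform `x̂ : G → A` of `x ∈ C*_r(Σ)`. -/
def hatF (D : CrossedProduct S B) (x : B) : G → A := fun g => D.E (x * star (D.u g))

/-- The norm `‖x‖_α = ‖x̂‖_α = ‖E(x* x)‖^{1/2}` on `C*_r(Σ)`. -/
def alphaNorm (D : CrossedProduct S B) (x : B) : ℝ := Real.sqrt ‖D.E (star x * x)‖

/-- `Λ_Σ(f) = ∑_g f(g) λ_Σ(g)` for finitely supported `f : G → A`. -/
def Lam (D : CrossedProduct S B) (f : G → A) : B := ∑ᶠ g, D.ι (f g) * D.u g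

/-- `CF(Σ)`: the set of `x ∈ C*_r(Σ)` whose Fourier series `∑_g x̂(g) λ_Σ(g)`
converges unconditionally in the operator norm. -/
def CFmem (D : CrossedProduct S B) (x : B) : Prop :=
  ∃ y : B, HasSum (fun g => D.ι (hatF D x g) * D.u g) y

/-- `M : C*_r(Σ) → C*_r(Σ)` is the bounded map associated with the (reduced)
multiplier `T : G × A → A`, i.e. `T ∈ MA(Σ)` with `M_T = M`. -/
def IsMultiplier (D : CrossedProduct S B) (T : G → A → A) (M : B →L[ℂ] B) : Prop :=
  (∀ g, IsLinearMap ℂ (T g)) ∧ ∀ g a, M (D.ι a * D.u g) = D.ι (T g a) * D.u g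

/-- The norm of a column vector in the Hilbert `B`-module `Bⁿ`. -/
def vecNorm {n : ℕ} (x : Fin n → B) : ℝ := Real.sqrt ‖∑ i, star (x i) * x i‖

/-- The C*-norm on `Mₙ(B)`, realized as the operator norm for the action of
matrices on the Hilbert `B`-module `Bⁿ`. -/
def matNorm {n : ℕ} (m : Matrix (Fin n) (Fin n) B) : ℝ :=
  sInf {M : ℝ | 0 ≤ M ∧ ∀ x : Fin n → B, vecNorm (m.mulVec x) ≤ M * vecNorm x}

/-- `φ : B → B` is completely bounded with cb-norm at most `M`. -/
def CBBoundedBy (φ : B → B) (M : ℝ) : Prop :=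
  0 ≤ M ∧ ∀ (n : ℕ) (m : Matrix (Fin n) (Fin n) B), matNorm (m.map φ) ≤ M * matNorm m

/-- The completely bounded norm `‖φ‖_cb`. -/
def cbNorm (φ : B → B) : ℝ := sInf {M : ℝ | CBBoundedBy φ M}

/-- `φ : B → B` is completely bounded. -/
def IsCompletelyBounded (φ : B → B) : Prop := ∃ M, CBBoundedBy φ M

/-- `φ : B → B` is completely positive. -/
def IsCompletelyPositive [PartialOrder B] [StarOrderedRing B] (φ : B → B) : Prop :=
  ∀ (n : ℕ) (b c : Fin n → B), 0 ≤ ∑ i, ∑ j, star (c i) * φ (star (b i) * b j) * c j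

/-- `ξ` tends to `0` at infinity w.r.t. the norm `N`. -/
def TendsZeroAtInfty (N : (G → A) → ℝ) (ξ : G → A) : Prop :=
  ∀ ε : ℝ, 0 < ε → ∃ F₀ : Finset G, ∀ F : Finset G, Disjoint F F₀ →
    N (Set.indicator (↑F : Set G) ξ) < ε

/-- The (closed, two-sided) ideal of `C*_r(Σ)` induced by a subset `J` of `A`. -/
def genIdeal (D : CrossedProduct S B) (J : Set A) : Set B :=
  closure ↑(Submodule.span ℂ {z : B | ∃ x y : B, ∃ j ∈ J, z = x * D.ι j * y})

/-- `J` is an `α`-invariant closed two-sided ideal of `A`. -/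
def IsInvIdeal (S : TwistedSystem A G) (J : Set A) : Prop :=
  IsClosed J ∧ (0 : A) ∈ J ∧ (∀ a b, a ∈ J → b ∈ J → a + b ∈ J) ∧
    (∀ a ∈ J, ∀ b : A, b * a ∈ J ∧ a * b ∈ J) ∧ ∀ g, ∀ a ∈ J, S.α g a ∈ J

/-- A closed two-sided ideal of a C*-algebra, as a set. -/
def IsClosedIdeal {B : Type*} [CStarAlgebra B] (I : Set B) : Prop :=
  IsClosed I ∧ (0 : B) ∈ I ∧ (∀ x y, x ∈ I → y ∈ I → x + y ∈ I) ∧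
    ∀ x ∈ I, ∀ b : B, b * x ∈ I ∧ x * b ∈ I

/-- An ideal `I` of `C*_r(Σ)` is `E`-invariant when `E(I) ⊆ I`. -/
def EInv (D : CrossedProduct S B) (I : Set B) : Prop := ∀ x ∈ I, D.ι (D.E x) ∈ I

/-- A Fourier summing net for `Σ`: a net `{Tⁱ}` in `MCF(Σ)` such that
`M_{Tⁱ}(x) → x` in norm for every `x ∈ C*_r(Σ)`. -/
structure FSNet {A G : Type*} [CStarAlgebra A] [Group G] {S : TwistedSystem A G}
    {B : Type*} [CStarAlgebra B] (D : CrossedProduct S B) where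
  Idx : Type
  pre : Preorder Idx
  dir : IsDirected Idx fun a b => pre.le a b
  nonempty : Nonempty Idx
  T : Idx → G → A → A
  T_lin : ∀ i g, IsLinearMap ℂ (T i g)
  M : Idx → B →L[ℂ] B
  M_mult : ∀ i g a, M i (D.ι a * D.u g) = D.ι (T i g a) * D.u g
  M_cf : ∀ i x, CFmem D (M i x)
  M_lim : ∀ x : B, Filter.Tendsto (fun i => ‖M i x - x‖) (@Filter.atTop Idx pre) (nhds 0)

/-- `Σ` has the bounded Fejér property: there is a bounded Fourier summing net for `Σ`
consisting of multipliers with finite `G`-support. -/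
def HasBoundedFejer (D : CrossedProduct S B) : Prop :=
  ∃ net : FSNet D, (∃ C : ℝ, ∀ i, ‖net.M i‖ ≤ C) ∧ ∀ i, {g | ∃ a, net.T i g a ≠ 0}.Finite


/-- A (right) Hilbert `A`-module structure on `X`: right `A`-action `smulA`,
`A`-valued inner product (linear in the second variable), with
`‖x‖ = ‖⟨x,x⟩‖^{1/2}`. -/
structure HilbMod (A : Type*) [CStarAlgebra A] [PartialOrder A] [StarOrderedRing A]
    (X : Type*) [NormedAddCommGroup X] [NormedSpace ℂ X] where
  smulA : X → A → X
  inner : X → X → A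
  smulA_add : ∀ x a b, smulA x (a + b) = smulA x a + smulA x b
  add_smulA : ∀ x y a, smulA (x + y) a = smulA x a + smulA y a
  smulA_mul : ∀ x a b, smulA x (a * b) = smulA (smulA x a) b
  smulA_one : ∀ x, smulA x 1 = x
  smulA_smul : ∀ (c : ℂ) x a, smulA (c • x) a = c • smulA x a
  smul_smulA : ∀ (c : ℂ) x a, smulA x (c • a) = c • smulA x a
  inner_add_right : ∀ x y z, inner x (y + z) = inner x y + inner x z
  inner_smulA_right : ∀ x y a, inner x (smulA y a) = inner x y * a
  inner_smul_right : ∀ (c : ℂ) x y, inner x (c • y) = c • inner x y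
  inner_conj : ∀ x y, star (inner x y) = inner y x
  inner_self_nonneg : ∀ x, 0 ≤ inner x x
  inner_self_eq_zero : ∀ x, inner x x = 0 → x = 0
  norm_eq : ∀ x, ‖x‖ = Real.sqrt ‖inner x x‖

/-- `π` is a representation of `A` by adjointable operators on the Hilbert
`A`-module `X`. -/
def IsRepOn {A X : Type*} [CStarAlgebra A] [PartialOrder A] [StarOrderedRing A]
    [NormedAddCommGroup X] [NormedSpace ℂ X] (hX : HilbMod A X) (π : A → X →L[ℂ] X) : Prop :=
  π 1 = ContinuousLinearMap.id ℂ X ∧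
  (∀ a b x, π (a * b) x = π a (π b x)) ∧
  (∀ a b, π (a + b) = π a + π b) ∧
  (∀ (c : ℂ) a, π (c • a) = c • π a) ∧
  (∀ a x y, hX.inner (π a x) y = hX.inner x (π (star a) y)) ∧
  ∀ a x b, π a (hX.smulA x b) = hX.smulA (π a x) b

/-- An equivariant representation `(ρ, v)` of `Σ` on a Hilbert `A`-module `X`. -/
structure EquivRep {A G : Type*} [CStarAlgebra A] [PartialOrder A] [StarOrderedRing A]
    [Group G] (S : TwistedSystem A G) {X : Type*} [NormedAddCommGroup X] [NormedSpace ℂ X]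
    (hX : HilbMod A X) where
  ρ : A → X →L[ℂ] X
  ρ_rep : IsRepOn hX ρ
  v : G → X ≃L[ℂ] X
  cov : ∀ g a x, ρ (S.α g a) x = v g (ρ a ((v g).symm x))
  v_mul : ∀ g h x, v g (v h x) = hX.smulA (ρ (S.σ g h) (v (g * h) x)) (star (S.σ g h))
  v_inner : ∀ g x y, S.α g (hX.inner x y) = hX.inner (v g x) (v g y)
  v_smulA : ∀ g x a, v g (hX.smulA x a) = hX.smulA (v g x) (S.α g a)

/-- The data of the quotient system `Σ̃ = (A/J, G, α̃, σ̃)`, its reduced crossed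
product, and the canonical map `q̃ : C*_r(Σ) → C*_r(Σ̃)`. -/
structure QuotientData {A G : Type*} [CStarAlgebra A] [Group G] {S : TwistedSystem A G}
    {B : Type*} [CStarAlgebra B] (D : CrossedProduct S B) (J : Set A) where
  Aq : Type
  [algAq : CStarAlgebra Aq]
  Sq : @TwistedSystem Aq G algAq _
  Bq : Type
  [algBq : CStarAlgebra Bq]
  Dq : @CrossedProduct Aq G algAq _ Sq Bq algBq
  q : A → Aq
  q_add : ∀ a b, q (a + b) = q a + q b
  q_mul : ∀ a b, q (a * b) = q a * q b
  q_star : ∀ a, q (star a) = star (q a)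
  q_smul : ∀ (c : ℂ) a, q (c • a) = c • q a
  q_one : q 1 = 1
  q_surj : Function.Surjective q
  q_ker : ∀ a, q a = 0 ↔ a ∈ J
  q_alpha : ∀ g a, q (S.α g a) = Sq.α g (q a)
  q_sigma : ∀ g h, q (S.σ g h) = Sq.σ g h
  Q : B → Bq
  Q_add : ∀ x y, Q (x + y) = Q x + Q y
  Q_smul : ∀ (c : ℂ) x, Q (c • x) = c • Q x
  Q_mul : ∀ x y, Q (x * y) = Q x * Q y
  Q_star : ∀ x, Q (star x) = star (Q x)
  Q_cont : Continuous Q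
  Q_gen : ∀ a g, Q (D.ι a * D.u g) = Dq.ι (q a) * Dq.u g

attribute [instance] QuotientData.algAq QuotientData.algBq

/-- The data of the reduced group C*-algebra `C*_r(G)`, the minimal tensor
product `C*_r(Σ) ⊗ C*_r(G)` and the reduced dual coaction
`δ_Σ : C*_r(Σ) → C*_r(Σ) ⊗ C*_r(G)`, `δ_Σ(a λ_Σ(g)) = a λ_Σ(g) ⊗ λ(g)`,
together with the slice map `id ⊗ τ` satisfying `(id ⊗ τ) ∘ δ_Σ = E`. -/
structure CoactionData {A G : Type*} [CStarAlgebra A] [Group G] {S : TwistedSystem A G}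
    {B : Type*} [CStarAlgebra B] (D : CrossedProduct S B) where
  CG : Type
  [algCG : CStarAlgebra CG]
  lam : G → CG
  lam_unitary : ∀ g, lam g ∈ unitary CG
  lam_mul : ∀ g h, lam (g * h) = lam g * lam h
  lam_gen : Dense (↑(Submodule.span ℂ (Set.range lam)) : Set CG)
  tau : CG →L[ℂ] ℂ
  tau_pos : ∀ c, 0 ≤ tau (star c * c)
  tau_lam_one : tau (lam 1) = 1
  tau_lam_ne : ∀ g, g ≠ 1 → tau (lam g) = 0
  BT : Type
  [algBT : CStarAlgebra BT]
  tens : B → CG → BT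
  tens_add_left : ∀ x y c, tens (x + y) c = tens x c + tens y c
  tens_add_right : ∀ x c d, tens x (c + d) = tens x c + tens x d
  tens_smul_left : ∀ (z : ℂ) x c, tens (z • x) c = z • tens x c
  tens_smul_right : ∀ (z : ℂ) x c, tens x (z • c) = z • tens x c
  tens_mul : ∀ x y c d, tens x c * tens y d = tens (x * y) (c * d)
  tens_star : ∀ x c, star (tens x c) = tens (star x) (star c)
  tens_norm : ∀ x c, ‖tens x c‖ = ‖x‖ * ‖c‖
  tens_gen : Dense (↑(Submodule.span ℂ {z : BT | ∃ x c, z = tens x c}) : Set BT)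
  slice : BT →L[ℂ] B
  slice_tens : ∀ x c, slice (tens x c) = tau c • x
  delta : B → BT
  delta_add : ∀ x y, delta (x + y) = delta x + delta y
  delta_smul : ∀ (z : ℂ) x, delta (z • x) = z • delta x
  delta_mul : ∀ x y, delta (x * y) = delta x * delta y
  delta_star : ∀ x, delta (star x) = star (delta x)
  delta_cont : Continuous delta
  delta_gen : ∀ a g, delta (D.ι a * D.u g) = tens (D.ι a * D.u g) (lam g)
  slice_delta : ∀ x, slice (delta x) = D.ι (D.E x)

attribute [instance] CoactionData.algCG CoactionData.algBT


namespace CrossedProduct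

theorem E_iota_mul (D : CrossedProduct S B) (a : A) (y : B) :
    D.E (D.ι a * y) = a * D.E y := by
  have h : D.E.comp (ContinuousLinearMap.mul ℂ B (D.ι a)) =
      (ContinuousLinearMap.mul ℂ A a).comp D.E := by
    refine ContinuousLinearMap.ext_on D.generated ?_
    rintro _ ⟨b, k, rfl⟩
    by_cases hk : k = 1
    · subst hk
      simp [D.u_one, ← map_mul, D.E_iota]
    · simp [← mul_assoc, ← map_mul, D.E_perp _ k hk]
  simpa using DFunLike.congr_fun h y

theorem E_mul_iota (D : CrossedProduct S B) (y : B) (a : A) :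
    D.E (y * D.ι a) = D.E y * a := by
  have h : D.E.comp ((ContinuousLinearMap.mul ℂ B).flip (D.ι a)) =
      ((ContinuousLinearMap.mul ℂ A).flip a).comp D.E := by
    refine ContinuousLinearMap.ext_on D.generated ?_
    rintro _ ⟨b, k, rfl⟩
    by_cases hk : k = 1
    · subst hk
      simp [D.u_one, ← map_mul, D.E_iota]
    · simp only [ContinuousLinearMap.comp_apply, ContinuousLinearMap.flip_apply,
        ContinuousLinearMap.mul_apply', D.E_perp _ k hk, mul_assoc, D.covariance]
      simp [← mul_assoc, ← map_mul, D.E_perp _ k hk]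
  simpa using DFunLike.congr_fun h y

theorem u_mul_star_u (D : CrossedProduct S B) (g : G) : D.u g * star (D.u g) = 1 :=
  (Unitary.mem_iff.1 (D.u_unitary g)).2

theorem star_iota_sigma_mul_u_mul_u (D : CrossedProduct S B) (g h : G) :
    D.ι (star (S.σ g h)) * (D.u g * D.u h) = D.u (g * h) := by
  rw [D.u_mul, ← mul_assoc, ← map_mul, (Unitary.mem_iff.1 (S.σ_unitary g h)).1, map_one, one_mul]

theorem E_conj_u (D : CrossedProduct S B) (g : G) (y : B) :
    D.E (D.u g * y * star (D.u g)) = S.α g (D.E y) := by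
  have h : (D.E.comp ((ContinuousLinearMap.mul ℂ B).flip (star (D.u g)))).comp
      (ContinuousLinearMap.mul ℂ B (D.u g)) =
      ContinuousLinearMap.comp ⟨(S.α g).toAlgEquiv.toLinearMap, (StarAlgEquiv.isometry (S.α g)).continuous⟩ D.E := by
    refine ContinuousLinearMap.ext_on D.generated ?_
    rintro _ ⟨b, k, rfl⟩
    by_cases hk : k = 1
    · subst hk
      simp [D.u_one, D.E_iota, D.covariance, mul_assoc, D.u_mul_star_u]
      rfl
    · have hconj : g * k * g⁻¹ ≠ 1 := by
        simpa [mul_inv_eq_one] using hk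
      have hu : D.u (g * k) = D.ι (star (S.σ (g * k * g⁻¹) g)) * (D.u (g * k * g⁻¹) * D.u g) := by
        rw [D.star_iota_sigma_mul_u_mul_u, inv_mul_cancel_right]
      have key : D.u g * (D.ι b * D.u k) * star (D.u g) =
          D.ι (S.α g b * S.σ g k * star (S.σ (g * k * g⁻¹) g)) * D.u (g * k * g⁻¹) := by
        rw [← mul_assoc, D.covariance, mul_assoc (D.ι _), D.u_mul, hu]
        simp only [map_mul, mul_assoc, D.u_mul_star_u, mul_one]
      change D.E (D.u g * (D.ι b * D.u k) * star (D.u g)) = S.α g (D.E (D.ι b * D.u k))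
      rw [key, D.E_perp _ k hk, D.E_perp _ _ hconj, map_zero]
  exact DFunLike.congr_fun h y

theorem hatF_iota_mul_u_mul (D : CrossedProduct S B) (a : A) (g h : G) (x : B) :
    hatF D (D.ι a * D.u g * x) h =
      a * S.α g (hatF D x (g⁻¹ * h)) * S.σ g (g⁻¹ * h) := by
  have hu : star (D.u h) =
      star (D.u (g⁻¹ * h)) * star (D.u g) * D.ι (S.σ g (g⁻¹ * h)) := by
    have := congrArg star (D.star_iota_sigma_mul_u_mul_u g (g⁻¹ * h))
    rw [mul_inv_cancel_left] at this
    rw [← this, star_mul, star_mul, ← map_star, star_star]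
  unfold hatF
  rw [hu, ← D.E_conj_u, ← D.E_iota_mul, ← D.E_mul_iota]
  simp only [mul_assoc]

theorem Lam_eq_sum (D : CrossedProduct S B) {f : G → A} (hf : (Function.support f).Finite) :
    Lam D f = ∑ g ∈ hf.toFinset, D.ι (f g) * D.u g := by
  refine finsum_eq_sum_of_support_subset _ fun g hg => ?_
  simp only [Set.Finite.coe_toFinset, Function.mem_support] at hg ⊢
  rintro h
  simp [h] at hg

theorem hatF_Lam_mul (D : CrossedProduct S B) {f : G → A} (hf : (Function.support f).Finite)
    (x : B) (h : G) :
    hatF D (Lam D f * x) h =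
      ∑ g ∈ hf.toFinset, f g * S.α g (hatF D x (g⁻¹ * h)) * S.σ g (g⁻¹ * h) := by
  simp_rw [← D.hatF_iota_mul_u_mul]
  simp only [hatF, D.Lam_eq_sum hf, Finset.sum_mul, map_sum]

end CrossedProduct

section Commutative

open WeakDual

variable {A G B : Type*} [CommCStarAlgebra A] [Group G] [CStarAlgebra B] {S : TwistedSystem A G}

theorem TwistedSystem.alpha_mul_comm (S : TwistedSystem A G) (g h : G) (a : A) :
    S.α (g * h) a = S.α g (S.α h a) := by
  rw [S.alpha_mul, mul_right_comm, (Unitary.mem_iff.1 (S.σ_unitary g h)).2, one_mul]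

theorem TwistedSystem.alpha_mul_symm_apply (S : TwistedSystem A G) (g h : G) (a : A) :
    (S.α (g * h)).symm (S.α g a) = (S.α h).symm a := by
  rw [← (S.α h).apply_symm_apply a, ← S.alpha_mul_comm]
  simp

theorem norm_character_of_mem_unitary (φ : characterSpace ℂ A) {a : A} (ha : a ∈ unitary A) :
    ‖φ a‖ = 1 :=
  CStarRing.norm_of_mem_unitary (Unitary.map_mem φ ha)

theorem character_star_mul_self (φ : characterSpace ℂ A) (a : A) :
    φ (star a * a) = ((‖φ a‖ ^ 2 : ℝ) : ℂ) := by
  rw [map_mul, map_star]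
  simpa using Complex.conj_mul' (φ a)

theorem eq_zero_of_forall_character {a : A} (h : ∀ φ : characterSpace ℂ A, φ a = 0) : a = 0 :=
  (injective_iff_map_eq_zero _).1 (gelfandTransform_isometry A).injective a
    (ContinuousMap.ext h)

/-- The scalar function `g ↦ φ(α_g⁻¹(x̂(g)))` associated with a character `φ` of `A`. -/
def charHat (D : CrossedProduct S B) (φ : characterSpace ℂ A) (x : B) (g : G) : ℂ :=
  φ ((S.α g).symm (hatF D x g))

theorem hasSum_ofReal_charHat (D : CrossedProduct S B) (φ : characterSpace ℂ A) (x : B) :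
    HasSum (fun g => ((‖charHat D φ x g‖ ^ 2 : ℝ) : ℂ)) (φ (D.E (star x * x))) := by
  rw [D.E_inner, innerAS]
  convert (D.hat_mem x).hasSum.map φ (map_continuous φ) using 2 with g
  rw [Function.comp_apply, map_mul, map_star, character_star_mul_self]
  rfl

theorem hasSum_charHat (D : CrossedProduct S B) (φ : characterSpace ℂ A) (x : B) :
    HasSum (fun g => ‖charHat D φ x g‖ ^ 2) (φ (D.E (star x * x))).re :=
  Complex.hasSum_re (hasSum_ofReal_charHat D φ x)

theorem character_E_star_mul_self_im (D : CrossedProduct S B) (φ : characterSpace ℂ A) (x : B) :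
    (φ (D.E (star x * x))).im = 0 :=
  (Complex.hasSum_im (hasSum_ofReal_charHat D φ x)).unique <| by
    simpa only [Complex.ofReal_im] using hasSum_zero

theorem norm_charHat_Lam_mul_le (D : CrossedProduct S B) (φ : characterSpace ℂ A) {f : G → A}
    (hf : (Function.support f).Finite) (hf_fix : ∀ g h, S.α h (f g) = f g) (x : B) (h : G) :
    ‖charHat D φ (Lam D f * x) h‖ ≤
      ∑ g ∈ hf.toFinset, ‖φ (f g)‖ * ‖charHat D φ x (g⁻¹ * h)‖ := by
  unfold charHat
  rw [D.hatF_Lam_mul hf, map_sum, map_sum]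
  refine (norm_sum_le _ _).trans (Finset.sum_le_sum fun g _ => ?_)
  have hfix : (S.α h).symm (f g) = f g := by
    rw [(S.α h).symm_apply_eq, hf_fix]
  have hα := S.alpha_mul_symm_apply g (g⁻¹ * h) (hatF D x (g⁻¹ * h))
  rw [mul_inv_cancel_left] at hα
  have hσ := norm_character_of_mem_unitary φ
    (Unitary.map_mem (S.α h).symm (S.σ_unitary g (g⁻¹ * h)))
  rw [map_mul, map_mul, map_mul, map_mul, hfix, hα, norm_mul, norm_mul, hσ, mul_one]

theorem norm_sq_le_of_forall_character_E_le (D : CrossedProduct S B) (T : B) {M : ℝ}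
    (hM : 0 ≤ M)
    (h : ∀ (φ : characterSpace ℂ A) (x : B),
      (φ (D.E (star (T * x) * (T * x)))).re ≤ M * (φ (D.E (star x * x))).re) :
    ‖T‖ ^ 2 ≤ M := by
  let _ := CStarAlgebra.spectralOrder B
  let _ := CStarAlgebra.spectralOrderedRing B
  refine le_of_forall_gt_imp_ge_of_dense fun c hc => ?_
  set d : B := star T * T - algebraMap ℝ B c with hd
  have hdsa : IsSelfAdjoint d :=
    (IsSelfAdjoint.star_mul_self T).sub (IsSelfAdjoint.algebraMap B (.all c))
  have hxsa : star d⁺ = d⁺ := (CFC.posPart_nonneg d).isSelfAdjoint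
  obtain ⟨z, hz⟩ := CStarAlgebra.nonneg_iff_eq_star_mul_self.1 (CFC.posPart_nonneg d)
  have hdd : d⁺ * d * d⁺ = star (z * d⁺) * (z * d⁺) := by
    nth_rewrite 2 [← CFC.posPart_sub_negPart d hdsa]
    rw [mul_sub, CFC.posPart_mul_negPart, sub_zero, star_mul, hxsa, mul_assoc d⁺ (star z),
      ← mul_assoc (star z), ← hz, mul_assoc]
  have hsum : star (T * d⁺) * (T * d⁺) = star (z * d⁺) * (z * d⁺) + (c : ℂ) • (star d⁺ * d⁺) := by
    have hT : star T * T = d + algebraMap ℝ B c := by simp [hd]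
    rw [← hdd, star_mul, mul_assoc, ← mul_assoc (star T), hT, hxsa, add_mul, mul_add,
      Algebra.algebraMap_eq_smul_one, smul_mul_assoc, one_mul, mul_smul_comm, mul_assoc,
      Complex.coe_smul]
  have hx : d⁺ = 0 := by
    refine D.E_faithful _ (eq_zero_of_forall_character fun φ => ?_)
    have hle := h φ d⁺
    rw [hsum, map_add, map_add, map_smul, map_smul, Complex.add_re, smul_eq_mul,
      Complex.re_ofReal_mul] at hle
    have hpos := (hasSum_charHat D φ (z * d⁺)).nonneg fun _ => sq_nonneg _
    have hpos' := (hasSum_charHat D φ d⁺).nonneg fun _ => sq_nonneg _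
    refine Complex.ext ?_ (character_E_star_mul_self_im D φ _)
    rw [Complex.zero_re]
    nlinarith
  have hdle : d ≤ 0 := (CFC.le_posPart hdsa).trans_eq hx
  rw [sq, ← CStarRing.norm_star_mul_self]
  exact (CStarAlgebra.norm_le_iff_le_algebraMap _ (hM.trans hc.le) (star_mul_self_nonneg T)).2
    (sub_nonpos.1 hdle)

end Commutative

/-- Proposition `commu`. If `A` is commutative and `G` is
`κ`-decaying with decay constant `C`, then `‖Λ_Σ(f)‖ ≤ C ‖f‖_{α,κ}` for every
`f ∈ C_c(Σ)` taking values in the fixed-point algebra `A^α`. -/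
theorem statement19 {A G B : Type*} [CommCStarAlgebra A] [Group G] [CStarAlgebra B]
    (S : TwistedSystem A G) (D : CrossedProduct S B)
    (κ : G → ℝ) (hκ : ∀ g, 1 ≤ κ g) (C : ℝ) (hC : 0 < C)
    -- `G` is `κ`-decaying with constant `C` ...
    (hCdec : ∀ f : G → ℂ, (Function.support f).Finite → ∀ ξ : G → ℂ,
      Summable (fun g => ‖ξ g‖ ^ 2) →
      Summable (fun h => ‖∑ᶠ g, f g * ξ (g⁻¹ * h)‖ ^ 2) ∧
      Real.sqrt (∑' h, ‖∑ᶠ g, f g * ξ (g⁻¹ * h)‖ ^ 2) ≤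
        C * Real.sqrt (∑' g, (‖f g‖ * κ g) ^ 2) * Real.sqrt (∑' g, ‖ξ g‖ ^ 2))
    -- ... and `C` is the least such constant (the decay constant)
    (hCleast : ∀ C' : ℝ, 0 < C' →
      (∀ f : G → ℂ, (Function.support f).Finite → ∀ ξ : G → ℂ,
        Summable (fun g => ‖ξ g‖ ^ 2) →
        Real.sqrt (∑' h, ‖∑ᶠ g, f g * ξ (g⁻¹ * h)‖ ^ 2) ≤
          C' * Real.sqrt (∑' g, (‖f g‖ * κ g) ^ 2) * Real.sqrt (∑' g, ‖ξ g‖ ^ 2)) →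
      C ≤ C')
    (f : G → A) (hf_fin : (Function.support f).Finite)
    (hf_fix : ∀ g h, S.α h (f g) = f g) :
    ‖Lam D f‖ ≤
      C * Real.sqrt ‖∑' g, ((κ g ^ 2 : ℝ) : ℂ) • (S.α g).symm (star (f g) * f g)‖ := by
  set N : A := ∑' g, ((κ g ^ 2 : ℝ) : ℂ) • (S.α g).symm (star (f g) * f g) with hN
  suffices h : ‖Lam D f‖ ^ 2 ≤ C ^ 2 * ‖N‖ by
    rw [← Real.sqrt_sq hC.le, ← Real.sqrt_mul (sq_nonneg C)]
    exact Real.le_sqrt_of_sq_le h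
  refine norm_sq_le_of_forall_character_E_le D _ (by positivity) fun φ x => ?_
  have hξ := hasSum_charHat D φ x
  have hη := hasSum_charHat D φ (Lam D f * x)
  have hconv (h : G) :
      ‖∑ᶠ g, ((‖φ (f g)‖ : ℝ) : ℂ) * ((‖charHat D φ x (g⁻¹ * h)‖ : ℝ) : ℂ)‖ =
        ∑ g ∈ hf_fin.toFinset, ‖φ (f g)‖ * ‖charHat D φ x (g⁻¹ * h)‖ := by
    rw [finsum_eq_sum_of_support_subset (s := hf_fin.toFinset)]
    · simp_rw [← Complex.ofReal_mul, ← Complex.ofReal_sum]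
      exact Complex.norm_of_nonneg (by positivity)
    · intro g hg
      simp only [Set.Finite.coe_toFinset, Function.mem_support] at hg ⊢
      rintro h0
      simp [h0] at hg
  have hfφ : (Function.support fun g => ((‖φ (f g)‖ : ℝ) : ℂ)).Finite := by
    refine hf_fin.subset fun g hg => ?_
    simp only [Function.mem_support] at hg ⊢
    rintro h0
    simp [h0] at hg
  obtain ⟨hsum, hle⟩ := hCdec (fun g => ((‖φ (f g)‖ : ℝ) : ℂ)) hfφ
    (fun g => ((‖charHat D φ x g‖ : ℝ) : ℂ)) (by simpa using hξ.summable)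
  simp only [hconv, Complex.norm_real, norm_norm] at hsum hle
  rw [hξ.tsum_eq] at hle
  have hweight : ∑' g, (‖φ (f g)‖ * κ g) ^ 2 ≤ ‖N‖ := by
    have hNsum : Summable fun g => ((κ g ^ 2 : ℝ) : ℂ) • (S.α g).symm (star (f g) * f g) := by
      refine summable_of_hasFiniteSupport (hf_fin.subset fun g hg => ?_)
      simp only [Function.mem_support] at hg ⊢
      rintro h0
      simp [h0] at hg
    have hNφ := Complex.hasSum_re (hNsum.hasSum.map φ (map_continuous φ))
    have heq (g : G) : (‖φ (f g)‖ * κ g) ^ 2 =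
        (φ (((κ g ^ 2 : ℝ) : ℂ) • (S.α g).symm (star (f g) * f g))).re := by
      have hfix : (S.α g).symm (f g) = f g := by
        rw [(S.α g).symm_apply_eq, hf_fix]
      rw [map_mul, map_star, hfix, map_smul, character_star_mul_self, smul_eq_mul,
        Complex.re_ofReal_mul, Complex.ofReal_re]
      ring
    simp_rw [heq]
    exact hNφ.tsum_eq.trans_le ((Complex.re_le_norm _).trans (NonUnitalStarAlgHom.norm_apply_le φ N))
  have hpos : 0 ≤ (φ (D.E (star x * x))).re := hξ.nonneg fun _ => sq_nonneg _
  calc (φ (D.E (star (Lam D f * x) * (Lam D f * x)))).re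
      ≤ ∑' h, (∑ g ∈ hf_fin.toFinset, ‖φ (f g)‖ * ‖charHat D φ x (g⁻¹ * h)‖) ^ 2 := by
        rw [← hη.tsum_eq]
        refine hη.summable.tsum_le_tsum (fun h => ?_) hsum
        exact pow_le_pow_left₀ (norm_nonneg _) (norm_charHat_Lam_mul_le D φ hf_fin hf_fix x h) 2
    _ ≤ (C * √(∑' g, (‖φ (f g)‖ * κ g) ^ 2) * √(φ (D.E (star x * x))).re) ^ 2 :=
        (Real.sqrt_le_left (by positivity)).1 hle
    _ = C ^ 2 * (∑' g, (‖φ (f g)‖ * κ g) ^ 2) * (φ (D.E (star x * x))).re := by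
        rw [mul_pow, mul_pow, Real.sq_sqrt (tsum_nonneg fun _ => sq_nonneg _), Real.sq_sqrt hpos]
    _ ≤ C ^ 2 * ‖N‖ * (φ (D.E (star x * x))).re := by gcongr

end BCFourier
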